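/- Fix a probability measure D on Z, an integer m ≥ 1, a prior probability measure P on H, and δ ∈ (0,1). With probability at least 1−δ over the draw of an i.i.d. sample S ~ D^⊗m, simultaneously for every probability measure Q on H, R_D(Q) ≤ kl⁻¹( R̂_S(Q), (KL(Q‖P) + ln(2√m/δ)) / m ). -/

import Mathlib

open MeasureTheory ENNReal

/-- Binary Kullback–Leibler divergence `kl(q,p)` for `q, p ∈ [0,1]`, with the conventions
`0 · ln 0 = 0` and `kl(q,p) = ∞` when `p ∈ {0,1}` and `q ≠ p`. -/
noncomputable def klBin (q p : ℝ) : ℝ≥0∞ :=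
  if (p = 0 ∨ p = 1) ∧ q ≠ p then ∞
  else ENNReal.ofReal (q * Real.log (q / p) + (1 - q) * Real.log ((1 - q) / (1 - p)))

open Classical in
/-- Kullback–Leibler divergence between measures, `+∞` if `Q` is not absolutely
continuous with respect to `P` (or if the log-likelihood ratio is not integrable,
in which case the divergence between probability measures is indeed infinite). -/
noncomputable def klDiv' {α : Type*} [MeasurableSpace α] (Q P : Measure α) : ℝ≥0∞ :=
  if Q ≪ P ∧ Integrable (fun x => Real.log (Q.rnDeriv P x).toReal) Q
  then ENNReal.ofReal (∫ x, Real.log (Q.rnDeriv P x).toReal ∂Q)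
  else ∞

/-- Inverse binary KL divergence: `kl⁻¹(x,b) = sup { y ∈ [x,1] : kl(x,y) ≤ b }`. -/
noncomputable def klInv (x : ℝ) (b : ℝ≥0∞) : ℝ :=
  sSup {y : ℝ | x ≤ y ∧ y ≤ 1 ∧ klBin x y ≤ b}

/-- Population risk of a hypothesis `h`. -/
noncomputable def riskD {H Z : Type*} [MeasurableSpace Z] (ℓ : H → Z → ℝ)
    (D : Measure Z) (h : H) : ℝ := ∫ z, ℓ h z ∂D

/-- Empirical risk of a hypothesis `h` on the sample `S`. -/
noncomputable def riskS {H Z : Type*} (ℓ : H → Z → ℝ) {m : ℕ} (S : Fin m → Z) (h : H) : ℝ :=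
  (1 / (m : ℝ)) * ∑ j, ℓ h (S j)

/-- Population risk of a distribution `Q` over hypotheses. -/
noncomputable def riskDQ {H Z : Type*} [MeasurableSpace H] [MeasurableSpace Z]
    (ℓ : H → Z → ℝ) (D : Measure Z) (Q : Measure H) : ℝ := ∫ h, riskD ℓ D h ∂Q

/-- Empirical risk of a distribution `Q` over hypotheses on the sample `S`. -/
noncomputable def riskSQ {H Z : Type*} [MeasurableSpace H] (ℓ : H → Z → ℝ) {m : ℕ}
    (S : Fin m → Z) (Q : Measure H) : ℝ := ∫ h, riskS ℓ S h ∂Q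

/-- The central binomial coefficient divided by `4 ^ k`. -/
noncomputable def centralProb (k : ℕ) : ℝ := k.centralBinom / 4 ^ k

lemma centralProb_pos (k : ℕ) : 0 < centralProb k :=
  div_pos (by exact_mod_cast k.centralBinom_pos) (by positivity)

lemma centralProb_succ (k : ℕ) :
    (k + 1) * centralProb (k + 1) = (k + 1 / 2) * centralProb k := by
  have h : ((k : ℝ) + 1) * (k + 1).centralBinom = 2 * (2 * k + 1) * k.centralBinom := by
    exact_mod_cast k.succ_mul_centralBinom_succ
  unfold centralProb
  rw [← mul_div_assoc, h, pow_succ]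
  field_simp
  ring

lemma sum_mul_centralProb (m : ℕ) :
    ∑ k ∈ Finset.range (m + 1), (k : ℝ) * (centralProb k * centralProb (m - k)) =
      m / 2 * ∑ k ∈ Finset.range (m + 1), centralProb k * centralProb (m - k) := by
  have h : ∑ k ∈ Finset.range (m + 1), (k : ℝ) * (centralProb k * centralProb (m - k)) =
      ∑ k ∈ Finset.range (m + 1), ((m : ℝ) - k) * (centralProb k * centralProb (m - k)) := by
    rw [← Finset.sum_range_reflect]
    refine Finset.sum_congr rfl fun k hk => ?_
    have hk' : k ≤ m := by simpa [Nat.lt_succ_iff] using hk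
    have h1 : m + 1 - 1 - k = m - k := by omega
    rw [h1, Nat.sub_sub_self hk', Nat.cast_sub hk', mul_comm (centralProb k)]
  simp only [sub_mul, Finset.sum_sub_distrib, ← Finset.mul_sum] at h
  linarith

lemma sum_centralProb_mul (m : ℕ) :
    ∑ k ∈ Finset.range (m + 1), centralProb k * centralProb (m - k) = 1 := by
  induction m with
  | zero => simp [centralProb]
  | succ m ih =>
    have h := sum_mul_centralProb (m + 1)
    rw [Finset.sum_range_succ'] at h
    have h2 : ∀ k ∈ Finset.range (m + 1),
        ((k + 1 : ℕ) : ℝ) * (centralProb (k + 1) * centralProb (m + 1 - (k + 1))) =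
          k * (centralProb k * centralProb (m - k)) +
            1 / 2 * (centralProb k * centralProb (m - k)) := by
      intro k _
      rw [Nat.add_sub_add_right, Nat.cast_succ, ← mul_assoc, centralProb_succ]
      ring
    rw [Finset.sum_congr rfl h2, Finset.sum_add_distrib, sum_mul_centralProb, ← Finset.mul_sum,
      ih] at h
    push_cast at h
    have hm : (m : ℝ) + 1 ≠ 0 := by positivity
    have h3 : ((m : ℝ) + 1) * 1 = (m + 1) *
        ∑ k ∈ Finset.range (m + 1 + 1), centralProb k * centralProb (m + 1 - k) := by linarith
    exact (mul_left_cancel₀ hm h3).symm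

lemma inv_centralProb_le {m : ℕ} (hm : 1 ≤ m) : (centralProb m)⁻¹ ≤ 2 * √m := by
  have h : 1 ≤ 4 * (m : ℝ) * centralProb m ^ 2 := by
    induction m, hm using Nat.le_induction with
    | base => norm_num [centralProb, Nat.centralBinom, Nat.choose]
    | succ m hm ih =>
      have hc := centralProb_succ m
      have hm0 : (0 : ℝ) < m := by exact_mod_cast hm
      have h1 : ((m : ℝ) + 1) * m * (4 * ((m : ℝ) + 1) * centralProb (m + 1) ^ 2) =
          (m + 1 / 2) ^ 2 * (4 * m * centralProb m ^ 2) := by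
        linear_combination 4 * (m : ℝ) * (((m : ℝ) + 1) * centralProb (m + 1) +
          (m + 1 / 2) * centralProb m) * hc
      push_cast
      have h2 : ((m : ℝ) + 1) * m * 1 ≤
          ((m : ℝ) + 1) * m * (4 * ((m : ℝ) + 1) * centralProb (m + 1) ^ 2) := by
        rw [h1]; nlinarith [sq_nonneg ((m : ℝ) + 1 / 2)]
      exact le_of_mul_le_mul_left h2 (by positivity)
  rw [inv_le_iff_one_le_mul₀ (centralProb_pos m)]
  have h3 := Real.sq_sqrt (Nat.cast_nonneg (α := ℝ) m)
  have := centralProb_pos m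
  refine (one_le_sq_iff₀ (by positivity)).1 ?_
  rw [mul_pow, mul_pow, h3]
  linarith

/-- The ratio of `k ^ k / k !` to `centralProb k`. -/
noncomputable def powerRatio (k : ℕ) : ℝ := (k : ℝ) ^ k / k.factorial / centralProb k

lemma powerRatio_pos (k : ℕ) : 0 < powerRatio k := by
  have := centralProb_pos k
  have : (0 : ℝ) < (k : ℝ) ^ k := by exact_mod_cast Nat.pow_self_pos
  unfold powerRatio
  positivity

/-- The quotient of consecutive values of `powerRatio`. -/
noncomputable def powerRatioStep (k : ℕ) : ℝ :=
  ((k + 1) / k : ℝ) ^ k * ((2 * k + 2) / (2 * k + 1))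

lemma powerRatioStep_pos (k : ℕ) : 0 < powerRatioStep k := by
  unfold powerRatioStep
  rcases k.eq_zero_or_pos with rfl | hk
  · norm_num
  · have : (0 : ℝ) < k := by exact_mod_cast hk
    positivity

lemma powerRatio_succ (k : ℕ) : powerRatio (k + 1) = powerRatio k * powerRatioStep k := by
  have hc : centralProb (k + 1) = (k + 1 / 2) / (k + 1) * centralProb k := by
    have := centralProb_succ k
    field_simp at this ⊢
    linarith
  have := centralProb_pos k
  have hk : (k : ℝ) ^ k ≠ 0 := by exact_mod_cast Nat.pow_self_pos.ne'
  unfold powerRatio powerRatioStep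
  rw [hc, Nat.factorial_succ, div_pow]
  push_cast
  field_simp
  ring

lemma log_powerRatioStep_monotoneOn :
    MonotoneOn (fun x : ℝ => x * (Real.log (x + 1) - Real.log x) +
      (Real.log (2 * x + 2) - Real.log (2 * x + 1))) (Set.Ioi 0) := by
  have hd : ∀ x ∈ Set.Ioi (0 : ℝ), HasDerivAt (fun x : ℝ => x * (Real.log (x + 1) - Real.log x) +
      (Real.log (2 * x + 2) - Real.log (2 * x + 1)))
      (1 * (Real.log (x + 1) - Real.log x) + x * (1 / (x + 1) - 1 / x) +
        (2 * 1 / (2 * x + 2) - 2 * 1 / (2 * x + 1))) x := by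
    intro x hx
    have hx : 0 < x := hx
    have h1 := ((hasDerivAt_id x).add_const 1).log (by simp; positivity)
    have h2 := (hasDerivAt_id x).log hx.ne'
    have h3 := (((hasDerivAt_id x).const_mul 2).add_const 2).log (by simp; positivity)
    have h4 := (((hasDerivAt_id x).const_mul 2).add_const 1).log (by simp; positivity)
    exact ((hasDerivAt_id x).mul (h1.sub h2)).add (h3.sub h4)
  refine monotoneOn_of_deriv_nonneg (convex_Ioi 0)
    (fun x hx => (hd x hx).continuousAt.continuousWithinAt)
    (fun x hx => ((hd x (by simpa using hx)).differentiableAt).differentiableWithinAt) ?_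
  intro x hx
  rw [interior_Ioi] at hx
  rw [(hd x hx).deriv]
  have hx : 0 < x := hx
  have h := Real.le_log_one_add_of_nonneg (x := 1 / x) (by positivity)
  rw [← Real.log_div (by positivity) hx.ne']
  have e : (x + 1) / x = 1 + 1 / x := by field_simp
  have e2 : 2 * (1 / x) / (1 / x + 2) = 2 / (2 * x + 1) := by field_simp; ring
  rw [e]
  rw [e2] at h
  have e3 : x * (1 / (x + 1) - 1 / x) + 2 * 1 / (2 * x + 2) = 0 := by field_simp; ring
  rw [mul_one] at *
  linarith

lemma powerRatioStep_monotone : Monotone powerRatioStep := by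
  refine monotone_nat_of_le_succ fun k => ?_
  rcases k.eq_zero_or_pos with rfl | hk
  · norm_num [powerRatioStep]
  have hlog : ∀ n : ℕ, 0 < n → Real.log (powerRatioStep n) =
      n * (Real.log (n + 1) - Real.log n) + (Real.log (2 * n + 2) - Real.log (2 * n + 1)) := by
    intro n hn
    have : (0 : ℝ) < n := by exact_mod_cast hn
    unfold powerRatioStep
    rw [Real.log_mul (by positivity) (by positivity), Real.log_pow,
      Real.log_div (by positivity) (by positivity), Real.log_div (by positivity) (by positivity)]
  rw [← Real.log_le_log_iff (powerRatioStep_pos _) (powerRatioStep_pos _), hlog k hk,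
    hlog (k + 1) k.succ_pos]
  refine log_powerRatioStep_monotoneOn (by simpa using hk) ?_ (by simp)
  simp only [Set.mem_Ioi]; positivity

lemma powerRatio_mul_le (a b : ℕ) : powerRatio a * powerRatio b ≤ powerRatio (a + b) := by
  induction b with
  | zero => simp [powerRatio, centralProb]
  | succ b ih =>
    rw [← add_assoc, powerRatio_succ, powerRatio_succ, ← mul_assoc]
    exact mul_le_mul ih (powerRatioStep_monotone (by omega)) (powerRatioStep_pos _).le
      (powerRatio_pos _).le

/-- The maximal likelihood of `k` successes among `m` independent Bernoulli trials. -/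
noncomputable def maxLikelihood (m k : ℕ) : ℝ :=
  ((k : ℝ) / m) ^ k * (((m - k : ℕ) : ℝ) / m) ^ (m - k)

lemma maxLikelihood_nonneg (m k : ℕ) : 0 ≤ maxLikelihood m k := by
  unfold maxLikelihood; positivity

lemma choose_mul_maxLikelihood_le {m k : ℕ} (hm : 1 ≤ m) (hk : k ≤ m) :
    m.choose k * maxLikelihood m k ≤ 2 * √m * (centralProb k * centralProb (m - k)) := by
  have hr := powerRatio_mul_le k (m - k)
  rw [Nat.add_sub_cancel' hk] at hr
  have hc := centralProb_pos
  have hrm := powerRatio_pos m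
  have hm0 : (0 : ℝ) < m := by exact_mod_cast hm
  have e : m.choose k * maxLikelihood m k =
      (centralProb m)⁻¹ * (centralProb k * centralProb (m - k)) *
        (powerRatio k * powerRatio (m - k) / powerRatio m) := by
    have h1 := (hc m).ne'
    have h2 := (hc k).ne'
    have h3 := (hc (m - k)).ne'
    unfold powerRatio maxLikelihood
    rw [Nat.cast_choose ℝ hk, div_pow, div_pow]
    have h4 : (m : ℝ) ^ m = m ^ k * m ^ (m - k) := by rw [← pow_add, Nat.add_sub_cancel' hk]
    rw [h4]
    field_simp
  rw [e]
  have h5 := inv_centralProb_le hm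
  have h6 : powerRatio k * powerRatio (m - k) / powerRatio m ≤ 1 := (div_le_one hrm).2 hr
  have h7 : 0 < centralProb k * centralProb (m - k) := mul_pos (hc _) (hc _)
  have h8 := hc m
  calc _ ≤ (centralProb m)⁻¹ * (centralProb k * centralProb (m - k)) * 1 := by gcongr
    _ ≤ _ := by rw [mul_one]; gcongr

lemma sum_choose_mul_maxLikelihood_le {m : ℕ} (hm : 1 ≤ m) :
    ∑ k ∈ Finset.range (m + 1), m.choose k * maxLikelihood m k ≤ 2 * √m := by
  calc _ ≤ ∑ k ∈ Finset.range (m + 1), 2 * √m * (centralProb k * centralProb (m - k)) :=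
        Finset.sum_le_sum fun k hk =>
          choose_mul_maxLikelihood_le hm (by simpa [Nat.lt_succ_iff] using hk)
    _ = 2 * √m := by rw [← Finset.mul_sum, sum_centralProb_mul, mul_one]

lemma pow_le_mul_exp {θ : ℝ} (hθ : 0 ≤ θ) {m : ℕ} (hm : 1 ≤ m) (k : ℕ) :
    θ ^ k ≤ ((k : ℝ) / m) ^ k * Real.exp (θ * m - k) := by
  rcases k.eq_zero_or_pos with rfl | hk
  · have : 0 ≤ θ * m := by positivity
    simpa using this
  have hk' : (0 : ℝ) < k := by exact_mod_cast hk
  have hm' : (0 : ℝ) < m := by exact_mod_cast hm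
  have h := Real.add_one_le_exp (θ * m / k - 1)
  rw [sub_add_cancel] at h
  have e : (k : ℝ) * (θ * m / k - 1) = θ * m - k := by field_simp
  rw [← e, Real.exp_nat_mul, ← mul_pow]
  refine pow_le_pow_left₀ hθ ?_ k
  calc θ = k / m * (θ * m / k) := by field_simp
    _ ≤ _ := by gcongr

lemma pow_mul_pow_le_maxLikelihood {θ : ℝ} (hθ : θ ∈ Set.Icc (0 : ℝ) 1) {m k : ℕ} (hm : 1 ≤ m)
    (hk : k ≤ m) : θ ^ k * (1 - θ) ^ (m - k) ≤ maxLikelihood m k := by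
  have h1 := pow_le_mul_exp hθ.1 hm k
  have h0 : 0 ≤ 1 - θ := sub_nonneg.2 hθ.2
  have h2 := pow_le_mul_exp h0 hm (m - k)
  have e : Real.exp (θ * m - k) * Real.exp ((1 - θ) * m - ((m - k : ℕ) : ℝ)) = 1 := by
    rw [← Real.exp_add, Nat.cast_sub hk, Real.exp_eq_one_iff]
    ring
  calc _ ≤ _ := mul_le_mul h1 h2 (by positivity) (by positivity)
    _ = maxLikelihood m k *
        (Real.exp (θ * m - k) * Real.exp ((1 - θ) * m - ((m - k : ℕ) : ℝ))) := by
      unfold maxLikelihood; ring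
    _ = _ := by rw [e, mul_one]

/-- The multilinear extension to `[0,1]^m` of the function which sends a `0`-`1` vector to the
ratio between its maximal Bernoulli likelihood and its likelihood under the parameter `p`. -/
noncomputable def likelihoodRatio {m : ℕ} (p : ℝ) (x : Fin m → ℝ) : ℝ :=
  ∑ T : Finset (Fin m), maxLikelihood m T.card *
    ∏ i, if i ∈ T then x i / p else (1 - x i) / (1 - p)

lemma likelihoodRatio_nonneg {m : ℕ} {p : ℝ} (hp : p ∈ Set.Icc (0 : ℝ) 1) {x : Fin m → ℝ}
    (hx : ∀ i, x i ∈ Set.Icc (0 : ℝ) 1) : 0 ≤ likelihoodRatio p x := by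
  refine Finset.sum_nonneg fun T _ => mul_nonneg (maxLikelihood_nonneg _ _)
    (Finset.prod_nonneg fun i _ => ?_)
  split_ifs
  · exact div_nonneg (hx i).1 hp.1
  · exact div_nonneg (sub_nonneg.2 (hx i).2) (sub_nonneg.2 hp.2)

lemma exp_mul_exp_le_factor {p x c d : ℝ} (hp : p ∈ Set.Icc (0 : ℝ) 1) (hx : x ∈ Set.Icc (0 : ℝ) 1)
    (h0 : p = 0 → x = 0) (h1 : p = 1 → x = 1) (hc : 0 < c) (hd : 0 < d) :
    Real.exp (x * Real.log c + (1 - x) * Real.log d + (1 - (p * c + (1 - p) * d))) ≤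
      p * c / (p * c + (1 - p) * d) * (x / p) +
        (1 - p * c / (p * c + (1 - p) * d)) * ((1 - x) / (1 - p)) := by
  obtain ⟨hp0, hp1⟩ := hp
  obtain ⟨hx0, hx1⟩ := hx
  set s := p * c + (1 - p) * d with hs
  have hs0 : 0 < s := by
    rcases hp0.eq_or_lt with h | h
    · rw [hs, ← h]; simpa using hd
    · have := mul_pos h hc
      have := mul_nonneg (sub_nonneg.2 hp1) hd.le
      linarith
  have hA : Real.exp (x * Real.log c + (1 - x) * Real.log d) ≤ x * c + (1 - x) * d := by
    have := convexOn_exp.2 (Set.mem_univ (Real.log c)) (Set.mem_univ (Real.log d)) hx0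
      (sub_nonneg.2 hx1) (by ring)
    simpa [Real.exp_log hc, Real.exp_log hd] using this
  have hB : Real.exp (1 - s) ≤ 1 / s := by
    have := Real.add_one_le_exp (s - 1)
    rw [show 1 - s = -(s - 1) by ring, Real.exp_neg, one_div]
    exact inv_anti₀ hs0 (by linarith)
  have hC : 0 ≤ x * c + (1 - x) * d := (Real.exp_pos _).le.trans hA
  rw [Real.exp_add]
  refine (mul_le_mul hA hB (Real.exp_pos _).le hC).trans (le_of_eq ?_)
  rcases hp0.eq_or_lt with h | h
  · have hx' := h0 h.symm
    have hsd : s = d := by rw [hs, ← h]; ring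
    rw [hx', ← h, hsd]; field_simp; simp
  rcases hp1.eq_or_lt with h' | h'
  · have hx' := h1 h'
    have hsc : s = c := by rw [hs, h']; ring
    rw [hx', h', hsc]; field_simp; simp
  · have h2 : 1 - p ≠ 0 := (sub_pos.2 h').ne'
    have h3 : 1 - p * c / s = (1 - p) * d / s := by
      rw [eq_div_iff hs0.ne', sub_mul, div_mul_cancel₀ _ hs0.ne', hs]; ring
    rw [h3]
    field_simp

lemma exp_le_likelihoodRatio {m : ℕ} (hm : 1 ≤ m) {p c d : ℝ} {x : Fin m → ℝ}
    (hp : p ∈ Set.Icc (0 : ℝ) 1) (hx : ∀ i, x i ∈ Set.Icc (0 : ℝ) 1)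
    (h0 : p = 0 → ∀ i, x i = 0) (h1 : p = 1 → ∀ i, x i = 1) (hc : 0 < c) (hd : 0 < d) :
    Real.exp (∑ i, (x i * Real.log c + (1 - x i) * Real.log d + (1 - (p * c + (1 - p) * d)))) ≤
      likelihoodRatio p x := by
  obtain ⟨hp0, hp1⟩ := hp
  set θ := p * c / (p * c + (1 - p) * d) with hθ
  have hp1' := sub_nonneg.2 hp1
  have hθ' : θ ∈ Set.Icc (0 : ℝ) 1 :=
    ⟨by positivity, div_le_one_of_le₀ (le_add_of_nonneg_right (by positivity)) (by positivity)⟩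
  rw [Real.exp_sum]
  refine (Finset.prod_le_prod (fun i _ => (Real.exp_pos _).le) fun i _ =>
    exp_mul_exp_le_factor ⟨hp0, hp1⟩ (hx i) (fun h => h0 h i) (fun h => h1 h i) hc hd).trans ?_
  rw [Fintype.prod_add]
  refine Finset.sum_le_sum fun T _ => ?_
  have hT : T.card ≤ m := by simpa using T.card_le_univ
  rw [← hθ, Finset.prod_mul_distrib, Finset.prod_mul_distrib, Finset.prod_const, Finset.prod_const,
    Finset.card_compl, Fintype.card_fin, mul_mul_mul_comm]
  have e : (∏ i, if i ∈ T then x i / p else (1 - x i) / (1 - p)) =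
      (∏ i ∈ T, x i / p) * ∏ i ∈ Tᶜ, (1 - x i) / (1 - p) := by
    rw [Finset.prod_ite]
    congr 1 <;> refine Finset.prod_congr ?_ fun _ _ => rfl <;> ext <;> simp
  rw [e]
  refine mul_le_mul_of_nonneg_right (pow_mul_pow_le_maxLikelihood hθ' hm hT) ?_
  exact mul_nonneg (Finset.prod_nonneg fun i _ => div_nonneg (hx i).1 hp0)
    (Finset.prod_nonneg fun i _ => div_nonneg (sub_nonneg.2 (hx i).2) hp1')

section

variable {Z : Type*} [MeasurableSpace Z] (D : Measure Z) [IsProbabilityMeasure D] {f : Z → ℝ}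

lemma integrable_of_mem_Icc (hf : Measurable f) (hb : ∀ z, f z ∈ Set.Icc (0 : ℝ) 1) :
    Integrable f D :=
  Integrable.of_mem_Icc 0 1 hf.aemeasurable (ae_of_all _ hb)

lemma integral_mem_Icc (hf : Measurable f) (hb : ∀ z, f z ∈ Set.Icc (0 : ℝ) 1) :
    ∫ z, f z ∂D ∈ Set.Icc (0 : ℝ) 1 := by
  refine ⟨integral_nonneg fun z => (hb z).1, ?_⟩
  calc _ ≤ ∫ _, (1 : ℝ) ∂D :=
        integral_mono (integrable_of_mem_Icc D hf hb) (integrable_const _) fun z => (hb z).2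
    _ = 1 := by simp

variable {D} in
lemma integrable_likelihoodRatio_term (hf : Measurable f) (hb : ∀ z, f z ∈ Set.Icc (0 : ℝ) 1)
    (p : ℝ) {m : ℕ} (T : Finset (Fin m)) :
    Integrable (fun S : Fin m → Z =>
      ∏ i, if i ∈ T then f (S i) / p else (1 - f (S i)) / (1 - p)) (Measure.pi fun _ => D) := by
  have hi := integrable_of_mem_Icc D hf hb
  refine Integrable.fintype_prod (μ := fun _ => D)
    (f := fun i z => if i ∈ T then f z / p else (1 - f z) / (1 - p)) fun i => ?_
  split_ifs
  · exact hi.div_const _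
  · exact ((integrable_const 1).sub hi).div_const _

lemma integrable_likelihoodRatio (hf : Measurable f) (hb : ∀ z, f z ∈ Set.Icc (0 : ℝ) 1)
    (p : ℝ) (m : ℕ) :
    Integrable (fun S : Fin m → Z => likelihoodRatio p fun i => f (S i))
      (Measure.pi fun _ => D) :=
  integrable_finsetSum _ fun T _ => (integrable_likelihoodRatio_term hf hb p T).const_mul _

lemma integral_likelihoodRatio_le (hf : Measurable f) (hb : ∀ z, f z ∈ Set.Icc (0 : ℝ) 1)
    {m : ℕ} (hm : 1 ≤ m) :
    ∫ S : Fin m → Z, likelihoodRatio (∫ z, f z ∂D) (fun i => f (S i)) ∂(Measure.pi fun _ => D) ≤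
      2 * √m := by
  have hi := integrable_of_mem_Icc D hf hb
  obtain ⟨hp0, hp1⟩ := integral_mem_Icc D hf hb
  set p := ∫ z, f z ∂D with hp
  unfold likelihoodRatio
  rw [integral_finsetSum _ fun T _ => (integrable_likelihoodRatio_term hf hb p T).const_mul _]
  calc _ ≤ ∑ T : Finset (Fin m), maxLikelihood m T.card := by
        refine Finset.sum_le_sum fun T _ => ?_
        rw [integral_const_mul]
        refine mul_le_of_le_one_right (maxLikelihood_nonneg _ _) ?_
        rw [integral_fintype_prod_eq_prod (μ := fun _ => D)
          (fun i z => if i ∈ T then f z / p else (1 - f z) / (1 - p))]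
        refine Finset.prod_le_one (fun i _ => ?_) fun i _ => ?_
        · refine integral_nonneg fun z => ?_
          dsimp only [Pi.zero_apply]
          split_ifs
          · exact div_nonneg (hb z).1 hp0
          · exact div_nonneg (sub_nonneg.2 (hb z).2) (sub_nonneg.2 hp1)
        · split_ifs
          · rw [integral_div, ← hp]
            exact div_self_le_one p
          · rw [integral_div, integral_sub (integrable_const 1) hi, ← hp]
            simpa using div_self_le_one (1 - p)
    _ = ∑ k ∈ Finset.range (m + 1), m.choose k * maxLikelihood m k := by
        rw [← Finset.powerset_univ, Finset.sum_powerset_apply_card (maxLikelihood m)]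
        simp
    _ ≤ _ := sum_choose_mul_maxLikelihood_le hm

end

/-- The easy half of the Donsker–Varadhan variational formula. -/
lemma integral_le_integral_llr_add_log {α : Type*} [MeasurableSpace α] {Q P : Measure α}
    [IsProbabilityMeasure Q] [IsProbabilityMeasure P] {g : α → ℝ} (hQP : Q ≪ P)
    (hllr : Integrable (llr Q P) Q) (hg : Integrable g Q)
    (hexp : Integrable (fun x => Real.exp (g x)) P) :
    ∫ x, g x ∂Q ≤ ∫ x, llr Q P x ∂Q + Real.log (∫ x, Real.exp (g x) ∂P) := by
  have : IsProbabilityMeasure (P.tilted g) := isProbabilityMeasure_tilted hexp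
  have hac : Q ≪ P.tilted g := hQP.trans (absolutelyContinuous_tilted hexp)
  have h := InformationTheory.toReal_klDiv_of_measure_eq hac (by simp)
  rw [integral_llr_tilted_right hQP hg hexp hllr] at h
  have := ENNReal.toReal_nonneg (a := InformationTheory.klDiv Q (P.tilted g))
  linarith

lemma integral_sum_le_integral_llr_add_log {H : Type*} [MeasurableSpace H] {Q P : Measure H}
    [IsProbabilityMeasure Q] [IsProbabilityMeasure P] (hQP : Q ≪ P)
    (hllr : Integrable (llr Q P) Q) {m : ℕ} (hm : 1 ≤ m) {p : H → ℝ} {x : H → Fin m → ℝ}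
    (hpm : Measurable p) (hxm : ∀ i, Measurable fun h => x h i)
    (hp : ∀ h, p h ∈ Set.Icc (0 : ℝ) 1) (hx : ∀ h i, x h i ∈ Set.Icc (0 : ℝ) 1)
    (hdeg : ∀ᵐ h ∂P, (p h = 0 → ∀ i, x h i = 0) ∧ (p h = 1 → ∀ i, x h i = 1))
    {K : ℝ} (hK : 0 < K) (hle : ∫⁻ h, ENNReal.ofReal (likelihoodRatio (p h) (x h)) ∂P ≤
      ENNReal.ofReal K) {c d : ℝ} (hc : 0 < c) (hd : 0 < d) :
    ∑ i, ((∫ h, x h i ∂Q) * Real.log c + (1 - ∫ h, x h i ∂Q) * Real.log d +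
        (1 - ((∫ h, p h ∂Q) * c + (1 - ∫ h, p h ∂Q) * d))) ≤
      ∫ h, llr Q P h ∂Q + Real.log K := by
  set g : Fin m → H → ℝ := fun i h => x h i * Real.log c + (1 - x h i) * Real.log d +
    (1 - (p h * c + (1 - p h) * d)) with hg
  have hip : Integrable p Q := integrable_of_mem_Icc Q hpm hp
  have hix : ∀ i, Integrable (fun h => x h i) Q := fun i =>
    integrable_of_mem_Icc Q (hxm i) fun h => hx h i
  have hi1 : Integrable (fun _ : H => (1 : ℝ)) Q := integrable_const 1
  have hA : ∀ i, Integrable (fun h => x h i * Real.log c + (1 - x h i) * Real.log d) Q := fun i =>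
    ((hix i).mul_const _).add ((hi1.sub (hix i)).mul_const _)
  have hB : Integrable (fun h => p h * c + (1 - p h) * d) Q :=
    (hip.mul_const _).add ((hi1.sub hip).mul_const _)
  have hgi : ∀ i, Integrable (g i) Q := fun i => (hA i).add (hi1.sub hB)
  have hgm : Measurable fun h => ∑ i, g i h :=
    Finset.measurable_fun_sum _ fun i _ => by
      have := hxm i
      fun_prop
  have hexp_le : ∫⁻ h, ENNReal.ofReal (Real.exp (∑ i, g i h)) ∂P ≤ ENNReal.ofReal K := by
    refine (lintegral_mono_ae ?_).trans hle
    filter_upwards [hdeg] with h hh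
    exact ENNReal.ofReal_le_ofReal
      (exp_le_likelihoodRatio hm (hp h) (hx h) hh.1 hh.2 hc hd)
  have hexpi : Integrable (fun h => Real.exp (∑ i, g i h)) P := by
    refine ⟨hgm.exp.aestronglyMeasurable, ?_⟩
    rw [hasFiniteIntegral_iff_ofReal (ae_of_all _ fun h => (Real.exp_pos _).le)]
    exact hexp_le.trans_lt ENNReal.ofReal_lt_top
  have hint : ∫ h, Real.exp (∑ i, g i h) ∂P ≤ K := by
    rw [← ENNReal.ofReal_le_ofReal_iff hK.le,
      ofReal_integral_eq_lintegral_ofReal hexpi (ae_of_all _ fun h => (Real.exp_pos _).le)]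
    exact hexp_le
  have hDV := integral_le_integral_llr_add_log hQP hllr (integrable_finsetSum _ fun i _ => hgi i)
    hexpi
  have hlog := Real.log_le_log (integral_exp_pos hexpi) hint
  refine le_trans (le_of_eq ?_) (hDV.trans (by linarith))
  rw [integral_finsetSum _ fun i _ => hgi i]
  refine Finset.sum_congr rfl fun i _ => ?_
  have e1 : ∫ h, g i h ∂Q = ∫ h, (x h i * Real.log c + (1 - x h i) * Real.log d) ∂Q +
      ∫ h, (1 - (p h * c + (1 - p h) * d)) ∂Q := integral_add (hA i) (hi1.sub hB)
  have e2 : ∀ {f : H → ℝ} (a b : ℝ), Integrable f Q →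
      ∫ h, (f h * a + (1 - f h) * b) ∂Q = (∫ h, f h ∂Q) * a + (1 - ∫ h, f h ∂Q) * b := by
    intro f a b hf
    have e3 : ∫ h, (1 - f h) ∂Q = 1 - ∫ h, f h ∂Q := by
      rw [integral_sub hi1 hf]; simp
    have e4 : ∫ h, (f h * a + (1 - f h) * b) ∂Q = ∫ h, f h * a ∂Q + ∫ h, (1 - f h) * b ∂Q :=
      integral_add (hf.mul_const _) ((hi1.sub hf).mul_const _)
    rw [e4, integral_mul_const, integral_mul_const, e3]
  rw [e1, e2 _ _ (hix i), integral_sub hi1 hB, e2 _ _ hip]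
  simp

lemma ae_eq_one_of_integral_eq_one {H : Type*} [MeasurableSpace H] {Q : Measure H}
    [IsProbabilityMeasure Q] {p : H → ℝ} (hpm : Measurable p)
    (hp : ∀ h, p h ∈ Set.Icc (0 : ℝ) 1) (h1 : ∫ h, p h ∂Q = 1) : ∀ᵐ h ∂Q, p h = 1 := by
  have hip : Integrable p Q := integrable_of_mem_Icc Q hpm hp
  have h0 : ∫ h, (1 - p h) ∂Q = 0 := by
    rw [integral_sub (integrable_const 1) hip, h1]; simp
  rw [integral_eq_zero_iff_of_nonneg (fun h => sub_nonneg.2 (hp h).2)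
    ((integrable_const 1).sub hip)] at h0
  filter_upwards [h0] with h hh
  exact (sub_eq_zero.1 hh).symm

/-- The binary divergence is at most any common upper bound of its tangents in the first
argument. -/
lemma binary_kl_le_of_forall {q p B : ℝ} (hq0 : 0 ≤ q) (hq1 : q < 1)
    (h : ∀ t ∈ Set.Ioo (0 : ℝ) 1,
      q * Real.log (t / p) + (1 - q) * Real.log ((1 - t) / (1 - p)) ≤ B) (hp : p < 1) :
    q * Real.log (q / p) + (1 - q) * Real.log ((1 - q) / (1 - p)) ≤ B := by
  rcases hq0.eq_or_lt with rfl | hq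
  · have hcont : ContinuousAt (fun t : ℝ => Real.log ((1 - t) / (1 - p))) 0 := by
      have : 0 < 1 - p := sub_pos.2 hp
      refine ContinuousAt.log (by fun_prop) ?_
      simp [this.ne']
    have := le_of_tendsto (hcont.tendsto.mono_left (nhdsWithin_le_nhds (s := Set.Ioi 0)))
      (b := B) (by
        filter_upwards [Ioo_mem_nhdsGT (zero_lt_one' ℝ)] with t ht
        simpa using h t ht)
    simpa using this
  · exact h q ⟨hq, hq1⟩

lemma le_klInv {q p : ℝ} {b : ℝ≥0∞} (hq : q ≤ p) (hp : p ≤ 1) (h : klBin q p ≤ b) :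
    p ≤ klInv q b :=
  le_csSup ⟨1, fun _ hy => hy.2.1⟩ ⟨hq, hp, h⟩

lemma le_klInv_self {q : ℝ} {b : ℝ≥0∞} (hq : q ≤ 1) : q ≤ klInv q b := by
  refine le_klInv le_rfl hq ?_
  simp [klBin]

lemma le_klInv_of_likelihoodRatio {H : Type*} [MeasurableSpace H] {Q P : Measure H}
    [IsProbabilityMeasure Q] [IsProbabilityMeasure P] {m : ℕ} (hm : 1 ≤ m) {p : H → ℝ}
    {x : H → Fin m → ℝ} (hpm : Measurable p) (hxm : ∀ i, Measurable fun h => x h i)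
    (hp : ∀ h, p h ∈ Set.Icc (0 : ℝ) 1) (hx : ∀ h i, x h i ∈ Set.Icc (0 : ℝ) 1)
    (hdeg : ∀ᵐ h ∂P, (p h = 0 → ∀ i, x h i = 0) ∧ (p h = 1 → ∀ i, x h i = 1))
    {K : ℝ} (hK : 0 < K) (hle : ∫⁻ h, ENNReal.ofReal (likelihoodRatio (p h) (x h)) ∂P ≤
      ENNReal.ofReal K) :
    ∫ h, p h ∂Q ≤ klInv (∫ h, 1 / (m : ℝ) * ∑ i, x h i ∂Q)
      ((klDiv' Q P + ENNReal.ofReal (Real.log K)) / (m : ℝ≥0∞)) := by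
  have hm0 : (0 : ℝ) < m := by exact_mod_cast hm
  have hix : ∀ i, Integrable (fun h => x h i) Q := fun i =>
    integrable_of_mem_Icc Q (hxm i) fun h => hx h i
  have hqm : Measurable fun h => 1 / (m : ℝ) * ∑ i, x h i :=
    (Finset.measurable_fun_sum _ fun i _ => hxm i).const_mul _
  have hqb : ∀ h, 1 / (m : ℝ) * ∑ i, x h i ∈ Set.Icc (0 : ℝ) 1 := by
    intro h
    refine ⟨mul_nonneg (by positivity) (Finset.sum_nonneg fun i _ => (hx h i).1), ?_⟩
    have : ∑ i, x h i ≤ m := by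
      simpa using Finset.sum_le_sum fun (i : Fin m) (_ : i ∈ Finset.univ) => (hx h i).2
    rw [one_div, inv_mul_le_iff₀ hm0]
    linarith
  obtain ⟨hp0, hp1⟩ := integral_mem_Icc Q hpm hp
  obtain ⟨hq0, hq1⟩ := integral_mem_Icc Q hqm hqb
  have hsum : ∑ i, ∫ h, x h i ∂Q = m * ∫ h, 1 / (m : ℝ) * ∑ i, x h i ∂Q := by
    rw [integral_const_mul, integral_finsetSum _ fun i _ => hix i]
    field_simp
  rcases le_or_gt (∫ h, p h ∂Q) (∫ h, 1 / (m : ℝ) * ∑ i, x h i ∂Q) with hpq | hqp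
  · exact hpq.trans (le_klInv_self hq1)
  by_cases hKL : Q ≪ P ∧ Integrable (fun x => Real.log (Q.rnDeriv P x).toReal) Q
  swap
  · refine hp1.trans (le_klInv hq1 le_rfl ?_)
    simp [klDiv', hKL, ENNReal.top_div]
  obtain ⟨hQP, hllr⟩ := hKL
  have hp1' : ∫ h, p h ∂Q < 1 := by
    refine lt_of_le_of_ne hp1 fun h1 => ?_
    have hae : (fun h => 1 / (m : ℝ) * ∑ i, x h i) =ᵐ[Q] fun _ => 1 := by
      filter_upwards [ae_eq_one_of_integral_eq_one hpm hp h1, hQP.ae_le hdeg] with h hh hh'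
      simp [hh'.2 hh, hm0.ne']
    rw [integral_congr_ae hae] at hqp
    simp at hqp
    linarith
  refine le_klInv hqp.le hp1 ?_
  set p₀ := ∫ h, p h ∂Q
  set q₀ := ∫ h, 1 / (m : ℝ) * ∑ i, x h i ∂Q
  have hp0' : 0 < p₀ := hq0.trans_lt hqp
  have hbound : q₀ * Real.log (q₀ / p₀) + (1 - q₀) * Real.log ((1 - q₀) / (1 - p₀)) ≤
      (∫ h, llr Q P h ∂Q + Real.log K) / m := by
    refine binary_kl_le_of_forall hq0 (hqp.trans hp1') (fun t ht => ?_) hp1'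
    have h1p : 0 < 1 - p₀ := sub_pos.2 hp1'
    have h := integral_sum_le_integral_llr_add_log hQP hllr hm hpm hxm hp hx hdeg hK hle
      (div_pos ht.1 hp0') (div_pos (sub_pos.2 ht.2) h1p)
    have e : p₀ * (t / p₀) + (1 - p₀) * ((1 - t) / (1 - p₀)) = 1 := by field_simp; ring
    simp only [show (∫ h, p h ∂Q) = p₀ from rfl, e, sub_self, add_zero] at h
    rw [Finset.sum_add_distrib, ← Finset.sum_mul, ← Finset.sum_mul, Finset.sum_sub_distrib,
      hsum] at h
    rw [le_div_iff₀ hm0]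
    simp only [Finset.sum_const, Finset.card_univ, Fintype.card_fin, nsmul_eq_mul, mul_one] at h
    linarith
  rw [klBin, if_neg (by rintro ⟨h | h, -⟩ <;> linarith), klDiv', if_pos ⟨hQP, hllr⟩]
  refine (ENNReal.ofReal_le_ofReal hbound).trans ?_
  rw [ENNReal.ofReal_div_of_pos hm0, ENNReal.ofReal_natCast]
  gcongr
  exact ENNReal.ofReal_add_le

lemma ae_degenerate {Z : Type*} [MeasurableSpace Z] (D : Measure Z) [IsProbabilityMeasure D]
    {f : Z → ℝ} (hf : Measurable f) (hb : ∀ z, f z ∈ Set.Icc (0 : ℝ) 1) (m : ℕ) :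
    ∀ᵐ S ∂(Measure.pi fun _ : Fin m => D), (∫ z, f z ∂D = 0 → ∀ i, f (S i) = 0) ∧
      (∫ z, f z ∂D = 1 → ∀ i, f (S i) = 1) := by
  have hz : ∀ᵐ z ∂D, (∫ z, f z ∂D = 0 → f z = 0) ∧ (∫ z, f z ∂D = 1 → f z = 1) := by
    refine Filter.Eventually.and ?_ ?_
    · by_cases h : ∫ z, f z ∂D = 0
      · have h' := h
        rw [integral_eq_zero_iff_of_nonneg (fun z => (hb z).1) (integrable_of_mem_Icc D hf hb)]
          at h'
        filter_upwards [h'] with z hz _ using hz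
      · exact ae_of_all _ fun z hz => absurd hz h
    · by_cases h : ∫ z, f z ∂D = 1
      · filter_upwards [ae_eq_one_of_integral_eq_one hf hb h] with z hz _ using hz
      · exact ae_of_all _ fun z hz => absurd hz h
  have hall : ∀ᵐ S ∂(Measure.pi fun _ : Fin m => D), ∀ i,
      (∫ z, f z ∂D = 0 → f (S i) = 0) ∧ (∫ z, f z ∂D = 1 → f (S i) = 1) :=
    ae_all_iff.2 fun i =>
      (measurePreserving_eval (fun _ : Fin m => D) i).quasiMeasurePreserving.ae hz
  filter_upwards [hall] with S hS
  exact ⟨fun h i => (hS i).1 h, fun h i => (hS i).2 h⟩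

/-- **Inverted McAllester–Maurer bound.** With probability at least `1 − δ` over `S ~ D^⊗m`,
simultaneously for every posterior `Q`,
`R_D(Q) ≤ kl⁻¹( R̂_S(Q), (KL(Q‖P) + ln(2√m/δ)) / m )`. -/
theorem mcallester_inverted_pac_bayes
    {H Z : Type*} [MeasurableSpace H] [MeasurableSpace Z]
    (ℓ : H → Z → ℝ) (hℓmeas : Measurable fun p : H × Z => ℓ p.1 p.2)
    (hℓbdd : ∀ h z, ℓ h z ∈ Set.Icc (0 : ℝ) 1)
    (D : Measure Z) [IsProbabilityMeasure D]
    (m : ℕ) (hm : 1 ≤ m)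
    (P : Measure H) [IsProbabilityMeasure P]
    (δ : ℝ) (hδ : δ ∈ Set.Ioo (0 : ℝ) 1) :
    ENNReal.ofReal (1 - δ) ≤
      (Measure.pi fun _ : Fin m => D)
        {S | ∀ Q : Measure H, IsProbabilityMeasure Q →
          riskDQ ℓ D Q ≤
            klInv (riskSQ ℓ S Q)
              ((klDiv' Q P + ENNReal.ofReal (Real.log (2 * Real.sqrt m / δ))) / (m : ℝ≥0∞))} := by
  obtain ⟨hδ0, hδ1⟩ := hδ
  have hm0 : (0 : ℝ) < m := by exact_mod_cast hm
  have hK : 0 < 2 * √(m : ℝ) / δ := by positivity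
  set μ : Measure (Fin m → Z) := Measure.pi fun _ => D with hμ
  have hℓ : ∀ h, Measurable (ℓ h) := fun h => hℓmeas.comp measurable_prodMk_left
  have hpm : Measurable (riskD ℓ D) :=
    (hℓmeas.stronglyMeasurable.integral_prod_right' (ν := D)).measurable
  have hpb : ∀ h, riskD ℓ D h ∈ Set.Icc (0 : ℝ) 1 := fun h => integral_mem_Icc D (hℓ h) (hℓbdd h)
  have hx2 : ∀ i, Measurable fun w : (Fin m → Z) × H => ℓ w.2 (w.1 i) := fun i =>
    hℓmeas.comp (measurable_snd.prodMk ((measurable_pi_apply i).comp measurable_fst))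
  have hp2 : Measurable fun w : (Fin m → Z) × H => riskD ℓ D w.2 := hpm.comp measurable_snd
  have hM2 : Measurable fun w : (Fin m → Z) × H =>
      ENNReal.ofReal (likelihoodRatio (riskD ℓ D w.2) fun i => ℓ w.2 (w.1 i)) := by
    refine (Finset.measurable_fun_sum _ fun T _ =>
      (Finset.measurable_fun_prod _ fun i _ => ?_).const_mul _).ennreal_ofReal
    have := hx2 i
    split_ifs <;> fun_prop
  set F : (Fin m → Z) → ℝ≥0∞ := fun S =>
    ∫⁻ h, ENNReal.ofReal (likelihoodRatio (riskD ℓ D h) fun i => ℓ h (S i)) ∂P with hF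
  have hFm : Measurable F := hM2.lintegral_prod_right'
  have hFint : ∫⁻ S, F S ∂μ ≤ ENNReal.ofReal (2 * √m) := by
    rw [hF, lintegral_lintegral_swap hM2.aemeasurable]
    calc _ ≤ ∫⁻ _, ENNReal.ofReal (2 * √m) ∂P := by
          refine lintegral_mono fun h => ?_
          dsimp only
          rw [← ofReal_integral_eq_lintegral_ofReal
            (integrable_likelihoodRatio D (hℓ h) (hℓbdd h) _ m)
            (ae_of_all _ fun S => likelihoodRatio_nonneg (hpb h) fun i => hℓbdd h (S i))]
          exact ENNReal.ofReal_le_ofReal (integral_likelihoodRatio_le D (hℓ h) (hℓbdd h) hm)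
      _ = _ := by simp
  have hmarkov : μ {S | ENNReal.ofReal (2 * √m / δ) ≤ F S} ≤ ENNReal.ofReal δ := by
    have h := (mul_meas_ge_le_lintegral (μ := μ) hFm (ENNReal.ofReal (2 * √m / δ))).trans hFint
    rw [show 2 * √(m : ℝ) = 2 * √m / δ * δ by field_simp, ENNReal.ofReal_mul hK.le,
      mul_div_cancel_right₀ _ hδ0.ne'] at h
    exact (ENNReal.mul_le_mul_iff_right (ENNReal.ofReal_pos.2 hK).ne' ENNReal.ofReal_ne_top).1 h
  have hdeg : ∀ᵐ S ∂μ, ∀ᵐ h ∂P, (riskD ℓ D h = 0 → ∀ i, ℓ h (S i) = 0) ∧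
      (riskD ℓ D h = 1 → ∀ i, ℓ h (S i) = 1) := by
    have hms : MeasurableSet {w : (Fin m → Z) × H |
        (riskD ℓ D w.2 = 0 → ∀ i, ℓ w.2 (w.1 i) = 0) ∧
          (riskD ℓ D w.2 = 1 → ∀ i, ℓ w.2 (w.1 i) = 1)} := by
      have key : ∀ a : ℝ, MeasurableSet {w : (Fin m → Z) × H |
          riskD ℓ D w.2 = a → ∀ i, ℓ w.2 (w.1 i) = a} := fun a => by
        have h2 : MeasurableSet {w : (Fin m → Z) × H | ∀ i, ℓ w.2 (w.1 i) = a} := by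
          rw [Set.ofPred_forall]
          exact MeasurableSet.iInter fun i => hx2 i (measurableSet_singleton a)
        exact MeasurableSet.imp (hp2 (measurableSet_singleton a)) h2
      exact (key 0).inter (key 1)
    rw [Measure.ae_ae_comm hms]
    exact ae_of_all _ fun h => ae_degenerate D (hℓ h) (hℓbdd h) m
  have hgood : ENNReal.ofReal (1 - δ) ≤ μ {S | F S < ENNReal.ofReal (2 * √m / δ)} := by
    have hc : {S | F S < ENNReal.ofReal (2 * √m / δ)} =
        {S | ENNReal.ofReal (2 * √m / δ) ≤ F S}ᶜ := by ext; simp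
    rw [hc, prob_compl_eq_one_sub (measurableSet_le measurable_const hFm),
      ENNReal.ofReal_sub _ hδ0.le, ENNReal.ofReal_one]
    gcongr
  refine hgood.trans (measure_mono_ae ?_)
  filter_upwards [hdeg] with S hS hFS Q hQ
  exact le_klInv_of_likelihoodRatio hm hpm (x := fun h i => ℓ h (S i))
    (fun i => hℓmeas.comp measurable_prodMk_right) hpb (fun h i => hℓbdd h (S i)) hS hK
    (le_of_lt hFS)
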